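/- arXiv:2408.07426 — 9 statements merged into one kernel-verified Lean document; each statement's English description precedes it below -/
import Mathlib

section
/- The Gel'fand–Fuchs map ω satisfies the Lie-algebra 2-cocycle identity: for all smooth 2π-periodic functions u, v, w : ℝ → ℝ, one has ω([u,v], w) + ω([w,u], v) + ω([v,w], u) = 0. -/
open Real

/-- The Lie bracket of vector fields on the circle, identified with smooth
2π-periodic functions: `[u,v] = u v' − v u'`. -/
noncomputable def vfBracket (u v : ℝ → ℝ) : ℝ → ℝ :=
  fun x => u x * deriv v x - v x * deriv u x

/-- The Gel'fand–Fuchs 2-cocycle `ω(u,v) = ∫₀^{2π} u'(x) v''(x) dx`. -/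
noncomputable def gfCocycle (u v : ℝ → ℝ) : ℝ :=
  ∫ x in (0:ℝ)..(2 * π), deriv u x * deriv (deriv v) x

theorem deriv_vfBracket_aux (u v : ℝ → ℝ)
    (hu : ContDiff ℝ (⊤ : ℕ∞) u) (hv : ContDiff ℝ (⊤ : ℕ∞) v) :
    deriv (vfBracket u v) =
      fun x => u x * deriv (deriv v) x - v x * deriv (deriv u) x := by
  have hu1 : ContDiff ℝ (⊤ : ℕ∞) (deriv u) := (contDiff_infty_iff_deriv.1 hu).2
  have hv1 : ContDiff ℝ (⊤ : ℕ∞) (deriv v) := (contDiff_infty_iff_deriv.1 hv).2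
  funext x
  have du := ((contDiff_infty_iff_deriv.1 hu).1 x).hasDerivAt
  have dv := ((contDiff_infty_iff_deriv.1 hv).1 x).hasDerivAt
  have du1 := ((contDiff_infty_iff_deriv.1 hu1).1 x).hasDerivAt
  have dv1 := ((contDiff_infty_iff_deriv.1 hv1).1 x).hasDerivAt
  have h : HasDerivAt (vfBracket u v) _ x := (du.mul dv1).sub (dv.mul du1)
  rw [h.deriv]
  ring

theorem gelfandFuchs_is_two_cocycle (u v w : ℝ → ℝ)
    (hu : ContDiff ℝ (⊤ : ℕ∞) u) (hup : Function.Periodic u (2 * π))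
    (hv : ContDiff ℝ (⊤ : ℕ∞) v) (hvp : Function.Periodic v (2 * π))
    (hw : ContDiff ℝ (⊤ : ℕ∞) w) (hwp : Function.Periodic w (2 * π)) :
    gfCocycle (vfBracket u v) w + gfCocycle (vfBracket w u) v
      + gfCocycle (vfBracket v w) u = 0 := by
  have c : ∀ f : ℝ → ℝ, ContDiff ℝ (⊤ : ℕ∞) f → Continuous (deriv (deriv f)) := fun f hf =>
    (contDiff_infty_iff_deriv.1 (contDiff_infty_iff_deriv.1 hf).2).2.continuous
  have cu := hu.continuous
  have cv := hv.continuous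
  have cw := hw.continuous
  have cu2 := c u hu
  have cv2 := c v hv
  have cw2 := c w hw
  unfold gfCocycle
  rw [deriv_vfBracket_aux u v hu hv, deriv_vfBracket_aux w u hw hu,
    deriv_vfBracket_aux v w hv hw]
  rw [← intervalIntegral.integral_add, ← intervalIntegral.integral_add]
  · refine (intervalIntegral.integral_congr (g := fun _ => (0 : ℝ)) ?_).trans
      intervalIntegral.integral_zero
    intro x _
    ring
  all_goals
    apply Continuous.intervalIntegrable
    fun_prop
end

section
/- The Gel'fand–Fuchs cocycle is not a coboundary: there exists no linear map α from the space of smooth 2π-periodic functions ℝ → ℝ to ℝ such that ω(u,v) = α(u v' − v u') for all smooth 2π-periodic functions u, v. -/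
open Real

lemma gf_deriv_cos (k : ℝ) : deriv (fun x : ℝ => cos (k * x)) = fun x => -k * sin (k * x) := by
  funext x
  have h := ((hasDerivAt_id x).const_mul k).cos
  simp only [id, mul_one] at h
  rw [h.deriv]; ring

lemma gf_deriv_sin (k : ℝ) : deriv (fun x : ℝ => sin (k * x)) = fun x => k * cos (k * x) := by
  funext x
  have h := ((hasDerivAt_id x).const_mul k).sin
  simp only [id, mul_one] at h
  rw [h.deriv]; ring

lemma gf_deriv2_sin (k : ℝ) :
    deriv (deriv (fun x : ℝ => sin (k * x))) = fun x => -k ^ 2 * sin (k * x) := by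
  rw [gf_deriv_sin]
  funext x
  have h := (((hasDerivAt_id x).const_mul k).cos).const_mul k
  simp only [id, mul_one] at h
  rw [h.deriv]; ring

lemma gf_bracket (k : ℝ) :
    vfBracket (fun x => cos (k * x)) (fun x => sin (k * x)) = k • (fun _ => (1 : ℝ)) := by
  funext x
  simp only [vfBracket, gf_deriv_cos, gf_deriv_sin, Pi.smul_apply, smul_eq_mul]
  linear_combination k * sin_sq_add_cos_sq (k * x)

lemma gf_value (k : ℕ) (hk : (k : ℝ) ≠ 0) :
    gfCocycle (fun x => cos (k * x)) (fun x => sin (k * x)) = (k : ℝ) ^ 3 * π := by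
  simp only [gfCocycle, gf_deriv_cos, gf_deriv2_sin]
  have h1 : ∀ x : ℝ, -(k : ℝ) * sin (k * x) * (-(k : ℝ) ^ 2 * sin (k * x))
      = (k : ℝ) ^ 3 * (fun y => sin y ^ 2) (k * x) := fun x => by ring
  have h2 : sin ((k : ℝ) * (2 * π)) = 0 := by
    have := sin_nat_mul_pi (k * 2)
    push_cast at this
    rw [← this]; ring_nf
  simp only [h1]
  rw [intervalIntegral.integral_const_mul, intervalIntegral.integral_comp_mul_left (fun y => sin y ^ 2) hk,
    integral_sin_sq, h2]
  simp
  field_simp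
  simp

/-- The Gel'fand–Fuchs cocycle is not a coboundary: there is no linear functional α
on the space of smooth 2π-periodic functions with ω(u,v) = α([u,v]) for all u, v. -/
theorem gelfandFuchs_not_coboundary :
    ¬ ∃ α : (ℝ → ℝ) → ℝ,
      (∀ u v : ℝ → ℝ, ContDiff ℝ (⊤ : ℕ∞) u → Function.Periodic u (2 * π) →
        ContDiff ℝ (⊤ : ℕ∞) v → Function.Periodic v (2 * π) → α (u + v) = α u + α v) ∧
      (∀ (c : ℝ) (u : ℝ → ℝ), ContDiff ℝ (⊤ : ℕ∞) u → Function.Periodic u (2 * π) →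
        α (c • u) = c * α u) ∧
      (∀ u v : ℝ → ℝ, ContDiff ℝ (⊤ : ℕ∞) u → Function.Periodic u (2 * π) →
        ContDiff ℝ (⊤ : ℕ∞) v → Function.Periodic v (2 * π) →
        gfCocycle u v = α (vfBracket u v)) := by
  rintro ⟨α, -, hs, hc⟩
  have key : ∀ k : ℕ, (k : ℝ) ≠ 0 → (k : ℝ) ^ 3 * π = k * α (fun _ => (1 : ℝ)) := by
    intro k hk
    rw [← gf_value k hk, ← hs k (fun _ => (1 : ℝ)) contDiff_const (fun _ => rfl), ← gf_bracket]
    refine hc _ _ (by fun_prop) ?_ (by fun_prop) ?_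
    · intro x
      have := cos_add_nat_mul_two_pi (k * x) k
      simpa [mul_add] using this
    · intro x
      have := sin_add_nat_mul_two_pi (k * x) k
      simpa [mul_add] using this
  have h1 := key 1 (by norm_num)
  have h2 := key 2 (by norm_num)
  push_cast at h1 h2
  linarith [pi_pos]
end

section
/- The Bott–Thurston map B satisfies the group 2-cocycle identity: for all lifts φ, ψ, ζ of orientation-preserving diffeomorphisms of the circle, B(φ∘ζ, ψ) + B(φ, ζ) = B(φ, ζ∘ψ) + B(ζ, ψ). -/
open Real

/-- A lift of an orientation-preserving diffeomorphism of the circle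
`S¹ = ℝ/2πℤ`: a smooth function with positive derivative commuting with the
translation by 2π. -/
def IsCircleDiffeoLift (φ : ℝ → ℝ) : Prop :=
  ContDiff ℝ (⊤ : ℕ∞) φ ∧ (∀ x, 0 < deriv φ x) ∧ ∀ x, φ (x + 2 * π) = φ x + 2 * π

/-- The Bott–Thurston 2-cocycle
`B(φ,ψ) = (1/2) ∫₀^{2π} log(φ'(ψ(x))) · (ψ''(x)/ψ'(x)) dx`. -/
noncomputable def bottThurston (φ ψ : ℝ → ℝ) : ℝ :=
  (1 / 2) * ∫ x in (0:ℝ)..(2 * π),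
    Real.log (deriv φ (ψ x)) * (deriv (deriv ψ) x / deriv ψ x)

lemma IsCircleDiffeoLift.deriv_periodic {φ : ℝ → ℝ} (h : IsCircleDiffeoLift φ) (x : ℝ) :
    deriv φ (x + 2 * π) = deriv φ x := by
  have h1 : (fun x => φ (x + 2 * π)) = fun x => φ x + 2 * π := funext h.2.2
  rw [← deriv_comp_add_const, h1, deriv_add_const]

lemma IsCircleDiffeoLift.deriv2_periodic {φ : ℝ → ℝ} (h : IsCircleDiffeoLift φ) (x : ℝ) :
    deriv (deriv φ) (x + 2 * π) = deriv (deriv φ) x := by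
  have h1 : (fun x => deriv φ (x + 2 * π)) = deriv φ := funext h.deriv_periodic
  rw [← deriv_comp_add_const, h1]

lemma IsCircleDiffeoLift.contDiff_deriv {φ : ℝ → ℝ} (h : IsCircleDiffeoLift φ) :
    ContDiff ℝ 1 (deriv φ) := by
  have h2 : ContDiff ℝ (1 + 1) φ := h.1.of_le (by norm_cast)
  exact (contDiff_succ_iff_deriv.1 h2).2.2

/-- The Bott–Thurston map satisfies the group 2-cocycle identity. -/
theorem bottThurston_group_cocycle (φ ψ ζ : ℝ → ℝ)
    (hφ : IsCircleDiffeoLift φ) (hψ : IsCircleDiffeoLift ψ)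
    (hζ : IsCircleDiffeoLift ζ) :
    bottThurston (φ ∘ ζ) ψ + bottThurston φ ζ
      = bottThurston φ (ζ ∘ ψ) + bottThurston ζ ψ := by
  have cφ := hφ.1.continuous
  have cψ := hψ.1.continuous
  have cζ := hζ.1.continuous
  have dφ : Differentiable ℝ φ := hφ.1.differentiable (by simp)
  have dψ : Differentiable ℝ ψ := hψ.1.differentiable (by simp)
  have dζ : Differentiable ℝ ζ := hζ.1.differentiable (by simp)
  have ddψ : Differentiable ℝ (deriv ψ) := hψ.contDiff_deriv.differentiable (by simp)
  have ddζ : Differentiable ℝ (deriv ζ) := hζ.contDiff_deriv.differentiable (by simp)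
  have c1φ := hφ.contDiff_deriv.continuous
  have c1ψ := hψ.contDiff_deriv.continuous
  have c1ζ := hζ.contDiff_deriv.continuous
  have c2ψ : Continuous (deriv (deriv ψ)) := hψ.contDiff_deriv.continuous_deriv le_rfl
  have c2ζ : Continuous (deriv (deriv ζ)) := hζ.contDiff_deriv.continuous_deriv le_rfl
  have nφ := fun x => (hφ.2.1 x).ne'
  have nψ := fun x => (hψ.2.1 x).ne'
  have nζ := fun x => (hζ.2.1 x).ne'
  have e1 : deriv (φ ∘ ζ) = fun x => deriv φ (ζ x) * deriv ζ x :=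
    funext fun x => deriv_comp x (dφ _) (dζ _)
  have e2 : deriv (ζ ∘ ψ) = fun x => deriv ζ (ψ x) * deriv ψ x :=
    funext fun x => deriv_comp x (dζ _) (dψ _)
  have e3 : ∀ x, deriv (deriv (ζ ∘ ψ)) x
      = deriv (deriv ζ) (ψ x) * deriv ψ x * deriv ψ x + deriv ζ (ψ x) * deriv (deriv ψ) x := by
    intro x
    rw [e2]
    exact (((ddζ (ψ x)).hasDerivAt.comp x (dψ x).hasDerivAt).mul (ddψ x).hasDerivAt).deriv
  set g : ℝ → ℝ := fun y => Real.log (deriv φ (ζ y)) * (deriv (deriv ζ) y / deriv ζ y) with hg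
  have cg : Continuous g :=
    ((c1φ.comp cζ).log fun x => nφ _).mul (c2ζ.div c1ζ nζ)
  have pg : Function.Periodic g (2 * π) := by
    intro x
    simp only [hg, hζ.2.2, hφ.deriv_periodic, hζ.deriv_periodic, hζ.deriv2_periodic]
  have sub : ∫ x in (0:ℝ)..(2 * π), g (ψ x) * deriv ψ x = ∫ x in (0:ℝ)..(2 * π), g x := by
    have h := intervalIntegral.integral_comp_mul_deriv (a := 0) (b := 2 * π) (f := ψ)
      (f' := deriv ψ) (g := g) (fun x _ => (dψ x).hasDerivAt) c1ψ.continuousOn cg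
    have hp := hψ.2.2 0
    rw [zero_add] at hp
    have h2 := pg.intervalIntegral_add_eq (ψ 0) 0
    rw [zero_add] at h2
    rw [← h2, ← hp, ← h]
    rfl
  have cA : Continuous fun x => Real.log (deriv φ (ζ (ψ x))) * (deriv (deriv ψ) x / deriv ψ x) :=
    ((c1φ.comp (cζ.comp cψ)).log fun x => nφ _).mul (c2ψ.div c1ψ nψ)
  have cB : Continuous fun x => Real.log (deriv ζ (ψ x)) * (deriv (deriv ψ) x / deriv ψ x) :=
    ((c1ζ.comp cψ).log fun x => nζ _).mul (c2ψ.div c1ψ nψ)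
  have cC : Continuous fun x => g (ψ x) * deriv ψ x := (cg.comp cψ).mul c1ψ
  have L : bottThurston (φ ∘ ζ) ψ = (1 / 2) * ((∫ x in (0:ℝ)..(2 * π),
      Real.log (deriv φ (ζ (ψ x))) * (deriv (deriv ψ) x / deriv ψ x)) + ∫ x in (0:ℝ)..(2 * π),
      Real.log (deriv ζ (ψ x)) * (deriv (deriv ψ) x / deriv ψ x)) := by
    rw [← intervalIntegral.integral_add (cA.intervalIntegrable _ _) (cB.intervalIntegrable _ _)]
    unfold bottThurston
    congr 2
    funext x
    rw [e1]
    simp only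
    rw [Real.log_mul (nφ _) (nζ _)]
    ring
  have R : bottThurston φ (ζ ∘ ψ) = (1 / 2) * ((∫ x in (0:ℝ)..(2 * π),
      Real.log (deriv φ (ζ (ψ x))) * (deriv (deriv ψ) x / deriv ψ x)) + ∫ x in (0:ℝ)..(2 * π),
      g (ψ x) * deriv ψ x) := by
    rw [← intervalIntegral.integral_add (cA.intervalIntegrable _ _) (cC.intervalIntegrable _ _)]
    unfold bottThurston
    congr 2
    funext x
    rw [e3, e2]
    simp only [hg, Function.comp]
    have := nψ x
    have := nζ (ψ x)
    field_simp
    ring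
  rw [L, R, sub]
  unfold bottThurston
  ring
end

section
/- Any circle diffeomorphism in the image of the exponential map that has no fixed points is conjugate to a rigid rotation: let f : ℝ → ℝ be smooth, 2π-periodic and everywhere positive, and let φ : ℝ × ℝ → ℝ be the (global) flow of the ODE x' = f(x), i.e. ∂ₜφ(t,x) = f(φ(t,x)) and φ(0,x) = x. Then there exist a lift ψ of an orientation-preserving circle diffeomorphism (ψ smooth, ψ' > 0, ψ(x+2π) = ψ(x)+2π) and θ ∈ ℝ such that ψ(φ(1,x)) = ψ(x) + θ for all x ∈ ℝ. -/
open Real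

/-- A fixed-point-free circle diffeomorphism in the image of the exponential map
(the time-one flow of a nowhere-vanishing vector field `f ∂ₓ`) is conjugate,
via an orientation-preserving circle diffeomorphism with lift `ψ`, to the rigid
rotation `x ↦ x + θ`. -/
theorem exp_image_no_fixed_points_conjugate_to_rotation (f : ℝ → ℝ)
    (hf : ContDiff ℝ (⊤ : ℕ∞) f) (hper : Function.Periodic f (2 * π))
    (hpos : ∀ x, 0 < f x)
    (φ : ℝ → ℝ → ℝ)
    (hflow : ∀ t x, HasDerivAt (fun s => φ s x) (f (φ t x)) t)
    (hinit : ∀ x, φ 0 x = x) :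
    ∃ (ψ : ℝ → ℝ) (θ : ℝ),
      ContDiff ℝ (⊤ : ℕ∞) ψ ∧ (∀ x, 0 < deriv ψ x) ∧
      (∀ x, ψ (x + 2 * π) = ψ x + 2 * π) ∧
      (∀ x, ψ (φ 1 x) = ψ x + θ) := by
  have hgc : ContDiff ℝ (⊤ : ℕ∞) (fun x => (f x)⁻¹) := hf.inv (fun x => (hpos x).ne')
  have hcont : Continuous (fun x => (f x)⁻¹) := hgc.continuous
  have hgper : Function.Periodic (fun x => (f x)⁻¹) (2 * π) := fun x => by
    simp only [hper x]
  have hIpos : 0 < ∫ y in (0 : ℝ)..(2 * π), (f y)⁻¹ :=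
    intervalIntegral.intervalIntegral_pos_of_pos
      (hcont.intervalIntegrable _ _) (fun x => inv_pos.mpr (hpos x)) Real.two_pi_pos
  set I := ∫ y in (0 : ℝ)..(2 * π), (f y)⁻¹ with hI
  set c := 2 * π / I with hc
  have hcpos : 0 < c := div_pos Real.two_pi_pos hIpos
  have hder : ∀ x, HasDerivAt (fun x => c * ∫ y in (0 : ℝ)..x, (f y)⁻¹) (c * (f x)⁻¹) x :=
    fun x => (intervalIntegral.integral_hasDerivAt_right (hcont.intervalIntegrable _ _)
      (hcont.stronglyMeasurableAtFilter _ _) hcont.continuousAt).const_mul c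
  have hderiv : deriv (fun x => c * ∫ y in (0 : ℝ)..x, (f y)⁻¹) = fun x => c * (f x)⁻¹ :=
    funext fun x => (hder x).deriv
  refine ⟨fun x => c * ∫ y in (0 : ℝ)..x, (f y)⁻¹, c, ?_, ?_, ?_, ?_⟩
  · rw [contDiff_infty_iff_deriv]
    refine ⟨fun x => (hder x).differentiableAt, ?_⟩
    rw [hderiv]
    exact contDiff_const.mul hgc
  · intro x
    rw [hderiv]
    exact mul_pos hcpos (inv_pos.mpr (hpos x))
  · intro x
    have h1 : (∫ y in (0 : ℝ)..(x + 2 * π), (f y)⁻¹)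
        = (∫ y in (0 : ℝ)..x, (f y)⁻¹) + ∫ y in x..(x + 2 * π), (f y)⁻¹ :=
      (intervalIntegral.integral_add_adjacent_intervals
        (hcont.intervalIntegrable _ _) (hcont.intervalIntegrable _ _)).symm
    have h2 : (∫ y in x..(x + 2 * π), (f y)⁻¹) = I := by
      have := hgper.intervalIntegral_add_eq x 0
      rw [zero_add] at this
      exact this
    have h3 : c * I = 2 * π := div_mul_cancel₀ _ hIpos.ne'
    simp only [h1, h2, mul_add, h3]
  · intro x
    have hd : ∀ t, HasDerivAt (fun t => (c * ∫ y in (0 : ℝ)..(φ t x), (f y)⁻¹) - c * t) 0 t := by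
      intro t
      have h1 := (hder (φ t x)).comp t (hflow t x)
      have h2 := h1.sub ((hasDerivAt_id t).const_mul c)
      have h3 : c * (f (φ t x))⁻¹ * f (φ t x) - c * 1 = 0 := by
        rw [mul_assoc, inv_mul_cancel₀ (hpos _).ne', sub_self]
      rw [h3] at h2
      exact h2
    have := is_const_of_deriv_eq_zero (fun t => (hd t).differentiableAt)
      (fun t => (hd t).deriv) 1 0
    simp only [hinit] at this
    show c * _ = c * _ + c
    linarith
end

section
/- Equality of Schwarzian derivatives implies a Möbius relation: let I ⊆ ℝ be a nonempty open interval and let φ, ψ : I → ℝ be smooth with nowhere-vanishing derivatives such that (Sφ)(x) = (Sψ)(x) for all x ∈ I. Then there exist a, b, c, d ∈ ℝ with ad − bc ≠ 0 such that c·φ(x) + d ≠ 0 and ψ(x) = (a·φ(x) + b)/(c·φ(x) + d) for all x ∈ I. -/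
open Real Set

/-- The Schwarzian derivative `(Sφ)(x) = φ'''/φ' − (3/2)(φ''/φ')²`. -/
noncomputable def schwarzian (φ : ℝ → ℝ) (x : ℝ) : ℝ :=
  deriv (deriv (deriv φ)) x / deriv φ x
    - (3 / 2) * (deriv (deriv φ) x / deriv φ x) ^ 2

theorem const_of_hasDerivAt_zero (p q : ℝ) (hpq : p < q) (f : ℝ → ℝ)
    (h : ∀ x ∈ Ioo p q, HasDerivAt f 0 x) : ∃ c, ∀ x ∈ Ioo p q, f x = c := by
  have := hpq
  refine isOpen_Ioo.exists_is_const_of_deriv_eq_zero isPreconnected_Ioo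
    (fun x hx => (h x hx).differentiableAt.differentiableWithinAt) (fun x hx => (h x hx).deriv)

theorem derivs_of_smooth (p q : ℝ) (f : ℝ → ℝ)
    (hf : ContDiffOn ℝ (⊤ : ℕ∞) f (Ioo p q)) :
    (∀ x ∈ Ioo p q, HasDerivAt f (deriv f x) x) ∧
    ContDiffOn ℝ (⊤ : ℕ∞) (deriv f) (Ioo p q) := by
  constructor
  · intro x hx
    exact ((hf.differentiableOn (by simp)).differentiableAt (isOpen_Ioo.mem_nhds hx)).hasDerivAt
  · exact hf.deriv_of_isOpen isOpen_Ioo (by simp)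

/-- Equality of Schwarzian derivatives on a nonempty open interval implies that
the two functions are related by a Möbius transformation. -/
theorem schwarzian_eq_implies_moebius (p q : ℝ) (hpq : p < q) (φ ψ : ℝ → ℝ)
    (hφ : ContDiffOn ℝ (⊤ : ℕ∞) φ (Ioo p q))
    (hφ' : ∀ x ∈ Ioo p q, deriv φ x ≠ 0)
    (hψ : ContDiffOn ℝ (⊤ : ℕ∞) ψ (Ioo p q))
    (hψ' : ∀ x ∈ Ioo p q, deriv ψ x ≠ 0)
    (hS : ∀ x ∈ Ioo p q, schwarzian φ x = schwarzian ψ x) :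
    ∃ a b c d : ℝ, a * d - b * c ≠ 0 ∧
      ∀ x ∈ Ioo p q, c * φ x + d ≠ 0 ∧ ψ x = (a * φ x + b) / (c * φ x + d) := by
  obtain ⟨d1, hφ1⟩ := derivs_of_smooth p q φ hφ
  obtain ⟨d2, hφ2⟩ := derivs_of_smooth p q _ hφ1
  obtain ⟨d3, -⟩ := derivs_of_smooth p q _ hφ2
  obtain ⟨e1, hψ1⟩ := derivs_of_smooth p q ψ hψ
  obtain ⟨e2, hψ2⟩ := derivs_of_smooth p q _ hψ1
  obtain ⟨e3, -⟩ := derivs_of_smooth p q _ hψ2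
  set u := deriv φ with hu
  set u1 := deriv u with hu1
  set u2 := deriv u1 with hu2
  set v := deriv ψ with hv
  set v1 := deriv v with hv1
  set v2 := deriv v1 with hv2
  have hS' : ∀ x ∈ Ioo p q, u2 x / u x - (3 / 2) * (u1 x / u x) ^ 2
      = v2 x / v x - (3 / 2) * (v1 x / v x) ^ 2 := hS
  -- the multiplier relating the two half-densities
  obtain ⟨r, hr0, hr⟩ : ∃ r : ℝ → ℝ, (∀ x ∈ Ioo p q, r x ≠ 0) ∧
      ∀ x ∈ Ioo p q, HasDerivAt r (r x / 2 * (u1 x / u x - v1 x / v x)) x := by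
    refine ⟨fun x => ((u x / v x) ^ 2) ^ (1 / 4 : ℝ), ?_, ?_⟩
    · intro x hx
      have h1 := hφ' x hx
      have h2 := hψ' x hx
      positivity
    · intro x hx
      have h1 := hφ' x hx
      have h2 := hψ' x hx
      have hpos : 0 < (u x / v x) ^ 2 := by positivity
      have := (((d2 x hx).div (e2 x hx) h2).pow 2).rpow_const (p := (1 / 4 : ℝ))
        (Or.inl hpos.ne')
      refine this.congr_deriv ?_
      simp only [Pi.div_apply, Pi.pow_apply]
      rw [Real.rpow_sub hpos, Real.rpow_one, show (2 - 1 : ℕ) = 1 from rfl, pow_one]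
      generalize ((u x / v x) ^ 2) ^ (1 / 4 : ℝ) = w
      field_simp
      ring
  obtain ⟨c, hc⟩ := const_of_hasDerivAt_zero p q hpq
    (fun x => r x / 2 * (u1 x / u x - v1 x / v x) / u x) (by
      intro x hx
      have h1 := hφ' x hx
      have h2 := hψ' x hx
      refine ((((hr x hx).div_const 2).mul (((d3 x hx).div (d2 x hx) h1).sub
        ((e3 x hx).div (e2 x hx) h2))).div (d2 x hx) h1).congr_deriv ?_
      have h3 := hS' x hx
      have h4 : u2 x = u x * ((3 / 2) * (u1 x / u x) ^ 2
        + (v2 x / v x - (3 / 2) * (v1 x / v x) ^ 2)) := by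
        rw [← h3]; field_simp; ring
      simp only [Pi.div_apply, Pi.sub_apply, Pi.mul_apply]
      rw [h4]
      field_simp
      ring)
  have hrc : ∀ x ∈ Ioo p q, r x / 2 * (u1 x / u x - v1 x / v x) = c * u x := by
    intro x hx
    have h1 := hφ' x hx
    rw [← hc x hx]
    field_simp
  obtain ⟨d, hd⟩ := const_of_hasDerivAt_zero p q hpq (fun x => r x - c * φ x) (by
    intro x hx
    refine ((hr x hx).sub ((d1 x hx).const_mul c)).congr_deriv ?_
    rw [hrc x hx]
    ring)
  obtain ⟨a, ha⟩ := const_of_hasDerivAt_zero p q hpq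
    (fun x => v x * r x / u x + c * ψ x) (by
      intro x hx
      have h1 := hφ' x hx
      have h2 := hψ' x hx
      refine ((((e2 x hx).mul (hr x hx)).div (d2 x hx) h1).add
        ((e1 x hx).const_mul c)).congr_deriv ?_
      have h3 : c = r x / 2 * (u1 x / u x - v1 x / v x) / u x := (hc x hx).symm
      simp only [Pi.mul_apply]
      rw [h3]
      field_simp
      ring)
  obtain ⟨b, hb⟩ := const_of_hasDerivAt_zero p q hpq (fun x => ψ x * r x - a * φ x) (by
    intro x hx
    have h1 := hφ' x hx
    refine (((e1 x hx).mul (hr x hx)).sub ((d1 x hx).const_mul a)).congr_deriv ?_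
    rw [hrc x hx, ← ha x hx]
    field_simp
    ring)
  have hr' : ∀ x ∈ Ioo p q, r x = c * φ x + d := by
    intro x hx
    have := hd x hx
    linarith
  refine ⟨a, b, c, d, ?_, ?_⟩
  · obtain ⟨x, hx⟩ : (Ioo p q).Nonempty := nonempty_Ioo.2 hpq
    have h1 := hφ' x hx
    have h2 := hψ' x hx
    have h3 := hr0 x hx
    have key : a * d - b * c = (v x * r x / u x) * r x := by
      have ha' := ha x hx
      have hb' := hb x hx
      have hd' := hd x hx
      rw [← hb', ← hd']
      linear_combination (-r x) * ha'
    rw [key]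
    exact mul_ne_zero (div_ne_zero (mul_ne_zero h2 h3) h1) h3
  · intro x hx
    have h3 := hr0 x hx
    rw [← hr' x hx]
    refine ⟨h3, ?_⟩
    have hb' := hb x hx
    rw [eq_div_iff h3]
    linarith
end

section
/- Generalised Galilean boost symmetry of the Hunter–Saxton equation: if f : ℝ × ℝ → ℝ is a smooth solution of u_txx + 2 u_x u_xx + u u_xxx = 0, then for every smooth function F : ℝ → ℝ the function g(t,x) = f(t, x − F(t)) + F'(t) is also a smooth solution. -/
open Real

/-- Partial derivative in the time variable of `f = f(t,x)`. -/
noncomputable def pt (f : ℝ × ℝ → ℝ) : ℝ × ℝ → ℝ :=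
  fun p => deriv (fun s => f (s, p.2)) p.1

/-- Partial derivative in the space variable of `f = f(t,x)`. -/
noncomputable def px (f : ℝ × ℝ → ℝ) : ℝ × ℝ → ℝ :=
  fun p => deriv (fun y => f (p.1, y)) p.2

/-- `f` solves the Hunter–Saxton equation `u_txx + 2 u_x u_xx + u u_xxx = 0`. -/
def IsHSSolution (f : ℝ × ℝ → ℝ) : Prop :=
  ∀ p : ℝ × ℝ,
    px (px (pt f)) p + 2 * px f p * px (px f) p + f p * px (px (px f)) p = 0

lemma hs_px_hasDerivAt {h : ℝ × ℝ → ℝ} (hh : Differentiable ℝ h) (p : ℝ × ℝ) :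
    px h p = fderiv ℝ h p (0, 1) := by
  have h1 : HasDerivAt (fun y : ℝ => (p.1, y)) ((0 : ℝ), (1 : ℝ)) p.2 :=
    (hasDerivAt_const _ _).prodMk (hasDerivAt_id _)
  exact ((hh (p.1, p.2)).hasFDerivAt.comp_hasDerivAt p.2 h1).deriv

lemma hs_pt_hasDerivAt {h : ℝ × ℝ → ℝ} (hh : Differentiable ℝ h) (p : ℝ × ℝ) :
    pt h p = fderiv ℝ h p (1, 0) := by
  have h1 : HasDerivAt (fun y : ℝ => (y, p.2)) ((1 : ℝ), (0 : ℝ)) p.1 :=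
    (hasDerivAt_id _).prodMk (hasDerivAt_const _ _)
  exact ((hh (p.1, p.2)).hasFDerivAt.comp_hasDerivAt p.1 h1).deriv

lemma hs_diff {h : ℝ × ℝ → ℝ} (hh : ContDiff ℝ (⊤ : ℕ∞) h) : Differentiable ℝ h :=
  hh.differentiable (by simp)

lemma hs_px_smooth {h : ℝ × ℝ → ℝ} (hh : ContDiff ℝ (⊤ : ℕ∞) h) :
    ContDiff ℝ (⊤ : ℕ∞) (px h) := by
  rw [show px h = fun p => fderiv ℝ h p (0, 1) from funext (hs_px_hasDerivAt (hs_diff hh))]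
  exact (hh.fderiv_right (m := (⊤ : ℕ∞)) (by simp)).clm_apply contDiff_const

lemma hs_pt_smooth {h : ℝ × ℝ → ℝ} (hh : ContDiff ℝ (⊤ : ℕ∞) h) :
    ContDiff ℝ (⊤ : ℕ∞) (pt h) := by
  rw [show pt h = fun p => fderiv ℝ h p (1, 0) from funext (hs_pt_hasDerivAt (hs_diff hh))]
  exact (hh.fderiv_right (m := (⊤ : ℕ∞)) (by simp)).clm_apply contDiff_const

lemma hs_px_shift (h : ℝ × ℝ → ℝ) (F c : ℝ → ℝ) :
    px (fun p : ℝ × ℝ => h (p.1, p.2 - F p.1) + c p.1) =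
      fun p : ℝ × ℝ => px h (p.1, p.2 - F p.1) := by
  funext p
  simp only [px, deriv_add_const]
  exact deriv_comp_sub_const (f := fun y => h (p.1, y)) (F p.1) p.2

lemma hs_px_shift' (h : ℝ × ℝ → ℝ) (F : ℝ → ℝ) :
    px (fun p : ℝ × ℝ => h (p.1, p.2 - F p.1)) =
      fun p : ℝ × ℝ => px h (p.1, p.2 - F p.1) := by
  simpa using hs_px_shift h F (fun _ => 0)

lemma hs_px_lin {h k : ℝ × ℝ → ℝ} (hh : Differentiable ℝ h) (hk : Differentiable ℝ k)
    (a c F : ℝ → ℝ) :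
    px (fun p : ℝ × ℝ => h (p.1, p.2 - F p.1) - a p.1 * k (p.1, p.2 - F p.1) + c p.1) =
      fun p : ℝ × ℝ => px h (p.1, p.2 - F p.1) - a p.1 * px k (p.1, p.2 - F p.1) := by
  funext p
  have e1 := congrFun (hs_px_shift' h F) p
  have e2 := congrFun (hs_px_shift' k F) p
  rw [← e1, ← e2]
  simp only [px, deriv_add_const]
  rw [deriv_fun_sub (by fun_prop) (by fun_prop), deriv_const_mul _ (by fun_prop)]

lemma hs_pt_shift {h : ℝ × ℝ → ℝ} (hh : Differentiable ℝ h) {F : ℝ → ℝ}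
    (hF : Differentiable ℝ F) (hF' : Differentiable ℝ (deriv F)) :
    pt (fun p : ℝ × ℝ => h (p.1, p.2 - F p.1) + deriv F p.1) =
      fun p : ℝ × ℝ => pt h (p.1, p.2 - F p.1) - deriv F p.1 * px h (p.1, p.2 - F p.1)
        + deriv (deriv F) p.1 := by
  funext p
  rw [hs_px_hasDerivAt hh, hs_pt_hasDerivAt hh]
  have h1 : HasDerivAt (fun s : ℝ => (s, p.2 - F s)) ((1 : ℝ), -deriv F p.1) p.1 :=
    (hasDerivAt_id _).prodMk ((hF p.1).hasDerivAt.const_sub _)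
  have h2 := (((hh (p.1, p.2 - F p.1)).hasFDerivAt.comp_hasDerivAt p.1 h1).add
    (hF' p.1).hasDerivAt).deriv
  refine h2.trans ?_
  rw [show ((1 : ℝ), -deriv F p.1) = ((1 : ℝ), (0 : ℝ)) - deriv F p.1 • ((0 : ℝ), (1 : ℝ)) by simp,
    map_sub, map_smul, smul_eq_mul]

/-- Generalised Galilean boost symmetry of the Hunter–Saxton equation. -/
theorem hunterSaxton_generalised_galilean_boost (f : ℝ × ℝ → ℝ)
    (hf : ContDiff ℝ (⊤ : ℕ∞) f) (hsol : IsHSSolution f)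
    (F : ℝ → ℝ) (hF : ContDiff ℝ (⊤ : ℕ∞) F) :
    ContDiff ℝ (⊤ : ℕ∞) (fun p : ℝ × ℝ => f (p.1, p.2 - F p.1) + deriv F p.1) ∧
      IsHSSolution (fun p : ℝ × ℝ => f (p.1, p.2 - F p.1) + deriv F p.1) := by
  have hF' : ContDiff ℝ (⊤ : ℕ∞) (deriv F) := (contDiff_infty_iff_deriv.1 hF).2
  refine ⟨by fun_prop, fun p => ?_⟩
  have hx := hs_px_smooth hf
  have ht := hs_pt_smooth hf
  have key := hs_px_lin (hs_diff (hs_px_smooth ht)) (hs_diff (hs_px_smooth hx))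
    (deriv F) (fun _ => 0) F
  simp only [add_zero] at key
  rw [hs_pt_shift (hs_diff hf) (hF.differentiable (by simp)) (hF'.differentiable (by simp)),
    hs_px_lin (hs_diff ht) (hs_diff hx), key, hs_px_shift f F (deriv F), hs_px_shift',
    hs_px_shift']
  have := hsol (p.1, p.2 - F p.1)
  simp only
  linear_combination this
end

section
/- Scaling symmetry of the dispersive Camassa–Holm equation: if f : ℝ × ℝ → ℝ is a smooth solution of u_t − u_txx + 3 u u_x − 2 u_x u_xx − u u_xxx + u_xxx = 0, then for every ε ∈ ℝ the function g(t,x) = e^ε f(e^ε t, x + (3/2) t (1 − e^ε)) + (e^ε − 1)/2 is also a smooth solution. -/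
open Real

/-- `f` solves the dispersive Camassa–Holm equation
`u_t − u_txx + 3 u u_x − 2 u_x u_xx − u u_xxx + u_xxx = 0`. -/
def IsDCHSolution (f : ℝ × ℝ → ℝ) : Prop :=
  ∀ p : ℝ × ℝ,
    pt f p - px (px (pt f)) p + 3 * f p * px f p
      - 2 * px f p * px (px f) p - f p * px (px (px f)) p
      + px (px (px f)) p = 0

lemma hasDerivAt_pt {f : ℝ × ℝ → ℝ} (hf : ContDiff ℝ (⊤ : ℕ∞) f) (p : ℝ × ℝ) :
    pt f p = fderiv ℝ f p (1, 0) := by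
  have h1 : HasDerivAt (fun s : ℝ => (s, p.2)) ((1 : ℝ), (0 : ℝ)) p.1 :=
    (hasDerivAt_id p.1).prodMk (hasDerivAt_const p.1 p.2)
  have h2 : HasFDerivAt f (fderiv ℝ f p) ((fun s : ℝ => (s, p.2)) p.1) :=
    (hf.differentiable (by simp) p).hasFDerivAt
  exact (h2.comp_hasDerivAt p.1 h1).deriv

lemma hasDerivAt_px {f : ℝ × ℝ → ℝ} (hf : ContDiff ℝ (⊤ : ℕ∞) f) (p : ℝ × ℝ) :
    px f p = fderiv ℝ f p (0, 1) := by
  have h1 : HasDerivAt (fun s : ℝ => (p.1, s)) ((0 : ℝ), (1 : ℝ)) p.2 :=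
    (hasDerivAt_const p.2 p.1).prodMk (hasDerivAt_id p.2)
  have h2 : HasFDerivAt f (fderiv ℝ f p) ((fun s : ℝ => (p.1, s)) p.2) :=
    (hf.differentiable (by simp) p).hasFDerivAt
  exact (h2.comp_hasDerivAt p.2 h1).deriv

lemma contDiff_pt {f : ℝ × ℝ → ℝ} (hf : ContDiff ℝ (⊤ : ℕ∞) f) :
    ContDiff ℝ (⊤ : ℕ∞) (pt f) := by
  rw [funext (hasDerivAt_pt hf)]
  exact (hf.fderiv_right (m := ((⊤ : ℕ∞) : WithTop ℕ∞)) (by simp)).clm_apply contDiff_const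

lemma contDiff_px {f : ℝ × ℝ → ℝ} (hf : ContDiff ℝ (⊤ : ℕ∞) f) :
    ContDiff ℝ (⊤ : ℕ∞) (px f) := by
  rw [funext (hasDerivAt_px hf)]
  exact (hf.fderiv_right (m := ((⊤ : ℕ∞) : WithTop ℕ∞)) (by simp)).clm_apply contDiff_const

/-- Derivative of `f` along a line. -/
lemma hasDerivAt_line {f : ℝ × ℝ → ℝ} (hf : ContDiff ℝ (⊤ : ℕ∞) f) {u v : ℝ → ℝ} {a b s : ℝ}
    (hu : HasDerivAt u a s) (hv : HasDerivAt v b s) :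
    HasDerivAt (fun r => f (u r, v r)) (a * pt f (u s, v s) + b * px f (u s, v s)) s := by
  have h2 : HasFDerivAt f (fderiv ℝ f (u s, v s)) ((fun r => (u r, v r)) s) :=
    (hf.differentiable (by simp) _).hasFDerivAt
  have h := h2.comp_hasDerivAt s (hu.prodMk hv)
  have e : ((a, b) : ℝ × ℝ) = a • ((1 : ℝ), (0 : ℝ)) + b • ((0 : ℝ), (1 : ℝ)) := by simp
  rw [e, map_add, map_smul, map_smul, ← hasDerivAt_pt hf, ← hasDerivAt_px hf] at h
  exact h

lemma px_comp {f g : ℝ × ℝ → ℝ} (hf : ContDiff ℝ (⊤ : ℕ∞) f) (hg : ContDiff ℝ (⊤ : ℕ∞) g)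
    (k l d a c : ℝ) :
    px (fun p => k * f (a * p.1, p.2 + (3 / 2) * p.1 * c)
        + l * g (a * p.1, p.2 + (3 / 2) * p.1 * c) + d)
      = fun p => k * px f (a * p.1, p.2 + (3 / 2) * p.1 * c)
        + l * px g (a * p.1, p.2 + (3 / 2) * p.1 * c) + 0 := by
  funext p
  have hu := hasDerivAt_const p.2 (a * p.1)
  have hv := (hasDerivAt_id p.2).add_const ((3 / 2) * p.1 * c)
  have h := (((hasDerivAt_line hf hu hv).const_mul k).add
    ((hasDerivAt_line hg hu hv).const_mul l)).add_const d
  refine h.deriv.trans ?_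
  simp

lemma pt_comp {f : ℝ × ℝ → ℝ} (hf : ContDiff ℝ (⊤ : ℕ∞) f) (k d a c : ℝ) :
    pt (fun p => k * f (a * p.1, p.2 + (3 / 2) * p.1 * c) + d)
      = fun p => (k * a) * pt f (a * p.1, p.2 + (3 / 2) * p.1 * c)
        + (k * (3 / 2 * c)) * px f (a * p.1, p.2 + (3 / 2) * p.1 * c) + 0 := by
  funext p
  have hu := (hasDerivAt_id p.1).const_mul a
  have hv := (((hasDerivAt_id p.1).const_mul (3 / 2)).mul_const c).const_add p.2
  have h := ((hasDerivAt_line hf hu hv).const_mul k).add_const d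
  refine h.deriv.trans ?_
  simp
  ring

/-- Scaling symmetry of the dispersive Camassa–Holm equation. -/
theorem dispersiveCamassaHolm_scaling (f : ℝ × ℝ → ℝ) (hf : ContDiff ℝ (⊤ : ℕ∞) f)
    (hsol : IsDCHSolution f) (ε : ℝ) :
    ContDiff ℝ (⊤ : ℕ∞) (fun p : ℝ × ℝ =>
        exp ε * f (exp ε * p.1, p.2 + (3 / 2) * p.1 * (1 - exp ε)) + (exp ε - 1) / 2) ∧
      IsDCHSolution (fun p : ℝ × ℝ =>
        exp ε * f (exp ε * p.1, p.2 + (3 / 2) * p.1 * (1 - exp ε)) + (exp ε - 1) / 2) := by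
  refine ⟨by fun_prop, ?_⟩
  intro p
  have hx := contDiff_px hf
  have hxx := contDiff_px hx
  have ht := contDiff_pt hf
  have htx := contDiff_px ht
  have e : ∀ d : ℝ, (fun p : ℝ × ℝ =>
      exp ε * f (exp ε * p.1, p.2 + (3 / 2) * p.1 * (1 - exp ε)) + d) = fun p : ℝ × ℝ =>
      exp ε * f (exp ε * p.1, p.2 + (3 / 2) * p.1 * (1 - exp ε))
      + 0 * f (exp ε * p.1, p.2 + (3 / 2) * p.1 * (1 - exp ε)) + d := by
    intro d; funext p; ring
  rw [pt_comp hf, px_comp ht hx, px_comp htx hxx, e, px_comp hf hf, px_comp hx hx,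
    px_comp hxx hxx]
  have h := hsol (exp ε * p.1, p.2 + (3 / 2) * p.1 * (1 - exp ε))
  linear_combination (exp ε) ^ 2 * h
end

section
/- Scaling symmetry of the dispersive Hunter–Saxton equation: if f : ℝ × ℝ → ℝ is a smooth solution of u_txx + 2 u_x u_xx + u u_xxx − u_xxx = 0, then for every ε ∈ ℝ the function g(t,x) = e^ε f(e^ε t, x) + 1 − e^ε is also a smooth solution. -/
open Real

/-- `f` solves the dispersive Hunter–Saxton equation
`u_txx + 2 u_x u_xx + u u_xxx − u_xxx = 0`. -/
def IsDHSSolution (f : ℝ × ℝ → ℝ) : Prop :=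
  ∀ p : ℝ × ℝ,
    px (px (pt f)) p + 2 * px f p * px (px f) p + f p * px (px (px f)) p
      - px (px (px f)) p = 0

theorem px_scale (f : ℝ × ℝ → ℝ) (a b c : ℝ) :
    px (fun p : ℝ × ℝ => c * f (a * p.1, p.2) + b) =
      fun p : ℝ × ℝ => c * px f (a * p.1, p.2) := by
  funext p
  simp only [px, deriv_add_const, deriv_const_mul_field]

theorem px_scale_zero (f : ℝ × ℝ → ℝ) (a c : ℝ) :
    px (fun p : ℝ × ℝ => c * f (a * p.1, p.2)) =
      fun p : ℝ × ℝ => c * px f (a * p.1, p.2) := by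
  funext p
  simp only [px, deriv_const_mul_field]

theorem pt_scale (f : ℝ × ℝ → ℝ) (a b c : ℝ) :
    pt (fun p : ℝ × ℝ => c * f (a * p.1, p.2) + b) =
      fun p : ℝ × ℝ => (c * a) * pt f (a * p.1, p.2) := by
  funext p
  have h := deriv_comp_mul_left a (fun s => f (s, p.2)) p.1
  simp only [smul_eq_mul] at h
  simp only [pt, deriv_add_const, deriv_const_mul_field, h, mul_assoc]

/-- Scaling symmetry of the dispersive Hunter–Saxton equation. -/
theorem dispersiveHunterSaxton_scaling (f : ℝ × ℝ → ℝ) (hf : ContDiff ℝ (⊤ : ℕ∞) f)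
    (hsol : IsDHSSolution f) (ε : ℝ) :
    ContDiff ℝ (⊤ : ℕ∞) (fun p : ℝ × ℝ => exp ε * f (exp ε * p.1, p.2) + 1 - exp ε) ∧
      IsDHSSolution (fun p : ℝ × ℝ => exp ε * f (exp ε * p.1, p.2) + 1 - exp ε) := by
  constructor
  · fun_prop
  · have e : (fun p : ℝ × ℝ => exp ε * f (exp ε * p.1, p.2) + 1 - exp ε) =
        fun p : ℝ × ℝ => exp ε * f (exp ε * p.1, p.2) + (1 - exp ε) := by
      funext p; ring
    rw [e]
    intro p
    rw [pt_scale, px_scale, px_scale_zero, px_scale_zero, px_scale_zero, px_scale_zero]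
    have h := hsol (exp ε * p.1, p.2)
    linear_combination (exp ε) ^ 2 * h
end

section
/- Generalised Galilean boost symmetry of the dispersive Hunter–Saxton equation: if f : ℝ × ℝ → ℝ is a smooth solution of u_txx + 2 u_x u_xx + u u_xxx − u_xxx = 0, then for every smooth function F : ℝ → ℝ the function g(t,x) = f(t, x − F(t)) + F'(t) is also a smooth solution. -/
open Real

theorem boost_px_eq (f : ℝ × ℝ → ℝ) (hf : ContDiff ℝ (⊤ : ℕ∞) f) (p : ℝ × ℝ) :
    px f p = fderiv ℝ f p (0, 1) := by
  have h1 : HasFDerivAt f (fderiv ℝ f p) (p.1, p.2) :=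
    (hf.differentiable (by simp) p).hasFDerivAt
  have h2 : HasDerivAt (fun y : ℝ => (p.1, y)) ((0 : ℝ), (1 : ℝ)) p.2 :=
    (hasDerivAt_const _ _).prodMk (hasDerivAt_id _)
  exact (h1.comp_hasDerivAt p.2 h2).deriv

theorem boost_pt_eq (f : ℝ × ℝ → ℝ) (hf : ContDiff ℝ (⊤ : ℕ∞) f) (p : ℝ × ℝ) :
    pt f p = fderiv ℝ f p (1, 0) := by
  have h1 : HasFDerivAt f (fderiv ℝ f p) (p.1, p.2) :=
    (hf.differentiable (by simp) p).hasFDerivAt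
  have h2 : HasDerivAt (fun y : ℝ => (y, p.2)) ((1 : ℝ), (0 : ℝ)) p.1 :=
    (hasDerivAt_id _).prodMk (hasDerivAt_const _ _)
  exact (h1.comp_hasDerivAt p.1 h2).deriv

theorem boost_px_smooth (f : ℝ × ℝ → ℝ) (hf : ContDiff ℝ (⊤ : ℕ∞) f) :
    ContDiff ℝ (⊤ : ℕ∞) (px f) := by
  rw [funext (boost_px_eq f hf)]
  exact (hf.fderiv_right (by simp)).clm_apply contDiff_const

theorem boost_pt_smooth (f : ℝ × ℝ → ℝ) (hf : ContDiff ℝ (⊤ : ℕ∞) f) :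
    ContDiff ℝ (⊤ : ℕ∞) (pt f) := by
  rw [funext (boost_pt_eq f hf)]
  exact (hf.fderiv_right (by simp)).clm_apply contDiff_const

/-- The space derivative commutes with the shift, and kills functions of time. -/
theorem boost_px_shift (f : ℝ × ℝ → ℝ) (F c : ℝ → ℝ) :
    px (fun p : ℝ × ℝ => f (p.1, p.2 - F p.1) + c p.1)
      = fun p => px f (p.1, p.2 - F p.1) := by
  funext p
  simp only [px, deriv_add_const]
  exact deriv_comp_sub_const (f := fun y => f (p.1, y)) (F p.1) p.2

theorem boost_px_shift0 (f : ℝ × ℝ → ℝ) (F : ℝ → ℝ) :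
    px (fun p : ℝ × ℝ => f (p.1, p.2 - F p.1))
      = fun p => px f (p.1, p.2 - F p.1) := by
  simpa using boost_px_shift f F (fun _ => 0)

theorem boost_pt_shift (f : ℝ × ℝ → ℝ) (hf : ContDiff ℝ (⊤ : ℕ∞) f)
    (F : ℝ → ℝ) (hF : ContDiff ℝ (⊤ : ℕ∞) F) (hF' : ContDiff ℝ (⊤ : ℕ∞) (deriv F)) :
    pt (fun p : ℝ × ℝ => f (p.1, p.2 - F p.1) + deriv F p.1)
      = fun p => (fun q : ℝ × ℝ => pt f q - deriv F q.1 * px f q) (p.1, p.2 - F p.1)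
          + deriv (deriv F) p.1 := by
  funext p
  have h1 : HasFDerivAt f (fderiv ℝ f (p.1, p.2 - F p.1)) (p.1, p.2 - F p.1) :=
    (hf.differentiable (by simp) _).hasFDerivAt
  have hFd : HasDerivAt F (deriv F p.1) p.1 := (hF.differentiable (by simp) _).hasDerivAt
  have hFd' : HasDerivAt (deriv F) (deriv (deriv F) p.1) p.1 :=
    (hF'.differentiable (by simp) _).hasDerivAt
  have h2 : HasDerivAt (fun y : ℝ => (y, p.2 - F y)) ((1 : ℝ), -deriv F p.1) p.1 :=
    (hasDerivAt_id _).prodMk (hFd.const_sub _)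
  have h3 := ((h1.comp_hasDerivAt p.1 h2).add hFd').deriv
  have h4 : ((1 : ℝ), -deriv F p.1) = (1, 0) + (-deriv F p.1) • ((0 : ℝ), (1 : ℝ)) := by
    simp
  rw [h4, map_add, map_smul, ← boost_pt_eq f hf, ← boost_px_eq f hf] at h3
  simp only [smul_eq_mul] at h3
  refine Eq.trans h3 ?_
  ring

theorem boost_px_comb (a b : ℝ × ℝ → ℝ) (ha : ContDiff ℝ (⊤ : ℕ∞) a)
    (hb : ContDiff ℝ (⊤ : ℕ∞) b) (c : ℝ → ℝ) :
    px (fun q : ℝ × ℝ => a q - c q.1 * b q) = fun q => px a q - c q.1 * px b q := by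
  funext p
  have da : DifferentiableAt ℝ (fun y => a (p.1, y)) p.2 :=
    (ha.comp (contDiff_const.prodMk contDiff_id)).differentiable (by simp) _
  have db : DifferentiableAt ℝ (fun y => b (p.1, y)) p.2 :=
    (hb.comp (contDiff_const.prodMk contDiff_id)).differentiable (by simp) _
  exact (da.hasDerivAt.sub (db.hasDerivAt.const_mul (c p.1))).deriv

/-- Generalised Galilean boost symmetry of the dispersive Hunter–Saxton equation. -/
theorem dispersiveHunterSaxton_generalised_galilean_boost (f : ℝ × ℝ → ℝ)
    (hf : ContDiff ℝ (⊤ : ℕ∞) f) (hsol : IsDHSSolution f)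
    (F : ℝ → ℝ) (hF : ContDiff ℝ (⊤ : ℕ∞) F) :
    ContDiff ℝ (⊤ : ℕ∞) (fun p : ℝ × ℝ => f (p.1, p.2 - F p.1) + deriv F p.1) ∧
      IsDHSSolution (fun p : ℝ × ℝ => f (p.1, p.2 - F p.1) + deriv F p.1) := by
  have hF' : ContDiff ℝ (⊤ : ℕ∞) (deriv F) := (contDiff_infty_iff_deriv.1 hF).2
  refine ⟨?_, ?_⟩
  · exact (hf.comp (contDiff_fst.prodMk (contDiff_snd.sub (hF.comp contDiff_fst)))).add
      (hF'.comp contDiff_fst)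
  · intro p
    have hx := boost_px_smooth f hf
    have hxx := boost_px_smooth _ hx
    have ht := boost_pt_smooth f hf
    have htx := boost_px_smooth _ ht
    rw [boost_pt_shift f hf F hF hF',
      boost_px_shift (fun q : ℝ × ℝ => pt f q - deriv F q.1 * px f q) F (deriv (deriv F)),
      boost_px_comb _ _ ht hx, boost_px_shift f F (deriv F), boost_px_shift0 (px f) F,
      boost_px_shift0 (px (px f)) F,
      boost_px_shift0 (fun q : ℝ × ℝ => px (pt f) q - deriv F q.1 * px (px f) q) F,
      boost_px_comb _ _ htx hxx]
    have := hsol (p.1, p.2 - F p.1)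
    simp only
    linarith
end
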